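/- arXiv:1908.02519 — 3 statements merged into one kernel-verified Lean document; each statement's English description precedes it below -/
import Mathlib

section
/- Let Γ_l > 0, α_s > 0, α_l > 0, κ_s ≥ 0 and κ_l ≥ 1/(2Γ_l). Let γ : ℝ → ℝ be differentiable with 0 < γ(t) < Γ_l for all t, and let e_s, e_l : ℝ × ℝ → ℝ be twice continuously differentiable with: (i) ∂t e_s(z,t) = α_s ∂z² e_s(z,t) and ∂t e_l(z,t) = α_l ∂z² e_l(z,t) for all (z,t) ∈ ℝ × ℝ; (ii) e_s(γ(t),t) = 0 and e_l(γ(t),t) = 0 for all t; (iii) ∂z e_s(0,t) = κ_s e_s(0,t) and ∂z e_l(Γ_l,t) = −κ_l e_l(Γ_l,t) for all t. Define V(t) := (1/2) ∫_0^{γ(t)} e_s(z,t)² dz + (1/2) ∫_{γ(t)}^{Γ_l} e_l(z,t)² dz and C := min(α_s, α_l)/(2Γ_l²). Then for all t ≥ 0: V(t) ≤ V(0) · exp(−C t). In particular the L² norm of the combined tracking error decays exponentially to zero. -/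
open Filter Topology in
lemma aux_leibniz (f f' : ℝ → ℝ → ℝ) (hf : Continuous (Function.uncurry f))
    (hf' : Continuous (Function.uncurry f'))
    (hd : ∀ z t, HasDerivAt (fun s => f z s) (f' z t) t)
    (γ : ℝ → ℝ) (t c : ℝ) (hγ : DifferentiableAt ℝ γ t) (h0 : f (γ t) t = 0) :
    HasDerivAt (fun s => ∫ z in c..γ s, f z s) (∫ z in c..γ t, f' z t) t := by
  have hfz : ∀ s, Continuous (fun z => f z s) := fun s =>
    hf.comp (by fun_prop : Continuous (fun z : ℝ => (z, s)))
  have hfz' : ∀ s, Continuous (fun z => f' z s) := fun s =>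
    hf'.comp (by fun_prop : Continuous (fun z : ℝ => (z, s)))
  have h1 : HasDerivAt (fun s => ∫ z in c..γ t, f z s) (∫ z in c..γ t, f' z t) t := by
    obtain ⟨M, hM⟩ := ((isCompact_uIcc (a := c) (b := γ t)).prod
      (isCompact_Icc (a := t - 1) (b := t + 1))).exists_bound_of_continuousOn hf'.continuousOn
    refine (intervalIntegral.hasDerivAt_integral_of_dominated_loc_of_deriv_le
      (F := fun s z => f z s) (F' := fun s z => f' z s) (bound := fun _ => M)
      (s := Set.Icc (t - 1) (t + 1)) (Icc_mem_nhds (by linarith) (by linarith))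
      (Eventually.of_forall fun s => (hfz s).aestronglyMeasurable)
      ((hfz t).intervalIntegrable _ _) ((hfz' t).aestronglyMeasurable) ?_ (by simp) ?_).2
    · refine Eventually.of_forall fun z hz s hs => ?_
      exact hM (z, s) ⟨Set.uIoc_subset_uIcc hz, hs⟩
    · exact Eventually.of_forall fun z _ s _ => hd z s
  have h2 : HasDerivAt (fun s => ∫ z in γ t..γ s, f z s) 0 t := by
    rw [hasDerivAt_iff_isLittleO]
    simp only [intervalIntegral.integral_same, sub_zero, smul_zero]
    have hO := hγ.hasDerivAt.isBigO_sub
    refine Asymptotics.IsLittleO.trans_isBigO ?_ hO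
    rw [Asymptotics.isLittleO_iff]
    intro ε hε
    have hc : ∀ᶠ p in 𝓝 (γ t, t), ‖Function.uncurry f p‖ < ε := by
      have := hf.norm.tendsto (γ t, t)
      simp only [Function.uncurry_apply_pair, h0, norm_zero] at this
      exact this.eventually (gt_mem_nhds hε)
    obtain ⟨δ, hδ, hball⟩ := Metric.eventually_nhds_iff.1 hc
    have hg : ∀ᶠ s in 𝓝 t, dist (γ s) (γ t) < δ :=
      hγ.continuousAt.eventually (Metric.ball_mem_nhds _ hδ)
    filter_upwards [hg, Metric.ball_mem_nhds t hδ] with s hs1 hs2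
    refine intervalIntegral.norm_integral_le_of_norm_le_const fun z hz => ?_
    have hz' : |z - γ t| ≤ |γ s - γ t| := by
      have := Set.abs_sub_left_of_mem_uIcc (Set.uIoc_subset_uIcc hz)
      exact this
    refine (hball (y := (z, s)) ?_).le
    rw [Prod.dist_eq]
    exact max_lt (lt_of_le_of_lt hz' hs1) hs2
  have h3 := h1.add h2
  rw [add_zero] at h3
  refine h3.congr_of_eventuallyEq (Eventually.of_forall fun s => ?_)
  simp only [Pi.add_apply]
  exact (intervalIntegral.integral_add_adjacent_intervals
    ((hfz s).intervalIntegrable _ _) ((hfz s).intervalIntegrable _ _)).symm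

lemma aux_energy (u u' u'' : ℝ → ℝ) (h1 : ∀ z, HasDerivAt u (u' z) z)
    (h2 : ∀ z, HasDerivAt u' (u'' z) z) (h3 : Continuous u'')
    (a b c Γ : ℝ) (hab : a ≤ b) (hΓ : 0 < Γ) (hc : ∀ z ∈ Set.Icc a b, |z - c| ≤ Γ)
    (hb1 : u b * u' b ≤ u a * u' a) (hb2 : (b - c) * u b ^ 2 = (a - c) * u a ^ 2) :
    ∫ z in a..b, u z * u'' z ≤ -(1 / (4 * Γ ^ 2)) * ∫ z in a..b, u z ^ 2 := by
  have hu : Continuous u := continuous_iff_continuousAt.2 fun z => (h1 z).continuousAt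
  have hu' : Continuous u' := continuous_iff_continuousAt.2 fun z => (h2 z).continuousAt
  have hG : ∀ z, HasDerivAt (fun z => u z * u' z + (z - c) * u z ^ 2 / (2 * Γ ^ 2))
      (u' z ^ 2 + u z * u'' z + (u z ^ 2 + 2 * (z - c) * u z * u' z) / (2 * Γ ^ 2)) z := by
    intro z
    have := ((h1 z).mul (h2 z)).add
      ((((hasDerivAt_id z).sub_const c).mul ((h1 z).pow 2)).div_const (2 * Γ ^ 2))
    refine this.congr_deriv ?_
    simp
    ring
  have hint := intervalIntegral.integral_eq_sub_of_hasDerivAt (a := a) (b := b)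
    (fun z _ => hG z) (Continuous.intervalIntegrable (by fun_prop) _ _)
  have hle : ∫ z in a..b, (u z * u'' z + (1 / (4 * Γ ^ 2)) * u z ^ 2) ≤
      ∫ z in a..b, (u' z ^ 2 + u z * u'' z
        + (u z ^ 2 + 2 * (z - c) * u z * u' z) / (2 * Γ ^ 2)) := by
    refine intervalIntegral.integral_mono_on hab (Continuous.intervalIntegrable (by fun_prop) _ _)
      (Continuous.intervalIntegrable (by fun_prop) _ _) fun z hz => ?_
    obtain ⟨w, hw⟩ : ∃ w, w = (z - c) / Γ := ⟨_, rfl⟩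
    obtain ⟨v, hv⟩ : ∃ v, v = u z / (2 * Γ) := ⟨_, rfl⟩
    have hw1 : w ^ 2 ≤ 1 := by
      rw [sq_le_one_iff_abs_le_one, hw, abs_div, abs_of_pos hΓ, div_le_one hΓ]
      exact hc z hz
    have e1 : z - c = w * Γ := by rw [hw]; field_simp
    have e2 : u z = v * (2 * Γ) := by rw [hv]; field_simp
    have key : 0 ≤ u' z ^ 2 + v ^ 2 + 2 * w * v * u' z := by
      nlinarith [sq_nonneg (u' z + w * v), mul_nonneg (sub_nonneg.2 hw1) (sq_nonneg v)]
    have e3 : (u z ^ 2 + 2 * (z - c) * u z * u' z) / (2 * Γ ^ 2)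
        = 2 * v ^ 2 + 2 * w * v * u' z := by
      rw [e1, e2]; field_simp
    have e4 : (1 / (4 * Γ ^ 2)) * u z ^ 2 = v ^ 2 := by
      rw [e2]; field_simp; ring
    rw [e3, e4]
    linarith
  rw [hint, intervalIntegral.integral_add (Continuous.intervalIntegrable (by fun_prop) _ _)
    (Continuous.intervalIntegrable (by fun_prop) _ _), intervalIntegral.integral_const_mul,
    hb2] at hle
  linarith

lemma aux_dz (n : ℕ) (g : ℝ → ℝ → ℝ) (hg : ContDiff ℝ (n + 1) (Function.uncurry g)) :
    ContDiff ℝ n (Function.uncurry fun z t => deriv (fun z' => g z' t) z) ∧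
    ∀ z t, HasDerivAt (fun z' => g z' t) (deriv (fun z' => g z' t) z) z := by
  have hd : ∀ z t, HasDerivAt (fun z' => g z' t) (fderiv ℝ (Function.uncurry g) (z, t) (1, 0)) z := by
    intro z t
    have h1 := ((hg.differentiable (by simp)) (z, t)).hasFDerivAt
    exact h1.comp_hasDerivAt z ((hasDerivAt_id z).prodMk (hasDerivAt_const z t))
  refine ⟨?_, fun z t => (hd z t).differentiableAt.hasDerivAt⟩
  have : (Function.uncurry fun z t => deriv (fun z' => g z' t) z)
      = fun p => fderiv ℝ (Function.uncurry g) p (1, 0) := by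
    ext ⟨z, t⟩
    exact (hd z t).deriv
  rw [this]
  exact (hg.fderiv_right le_rfl).clm_apply contDiff_const

lemma aux_dt (g : ℝ → ℝ → ℝ) (hg : ContDiff ℝ 2 (Function.uncurry g)) (z t : ℝ) :
    HasDerivAt (fun s => g z s) (deriv (fun s => g z s) t) t := by
  have h1 := ((hg.differentiable (by simp)) (z, t)).hasFDerivAt
  exact (h1.comp_hasDerivAt t
    ((hasDerivAt_const t z).prodMk (hasDerivAt_id t))).differentiableAt.hasDerivAt

/-- Everything needed for one phase. -/
lemma aux_phase (α : ℝ) (e : ℝ → ℝ → ℝ) (he : ContDiff ℝ 2 (Function.uncurry e))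
    (heat : ∀ z t, deriv (fun s => e z s) t
      = α * deriv (fun z' => deriv (fun z'' => e z'' t) z') z)
    (γ : ℝ → ℝ) (hγ : Differentiable ℝ γ) (hb : ∀ t, e (γ t) t = 0) (c t : ℝ) :
    HasDerivAt (fun s => ∫ z in c..γ s, e z s ^ 2)
      (2 * α * ∫ z in c..γ t, e z t * deriv (fun z' => deriv (fun z'' => e z'' t) z') z) t
    ∧ (∀ z, HasDerivAt (fun z => e z t) (deriv (fun z'' => e z'' t) z) z)
    ∧ (∀ z, HasDerivAt (fun z' => deriv (fun z'' => e z'' t) z')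
        (deriv (fun z' => deriv (fun z'' => e z'' t) z') z) z)
    ∧ Continuous (fun z => deriv (fun z' => deriv (fun z'' => e z'' t) z') z) := by
  obtain ⟨c1, d1⟩ := aux_dz 1 e (by norm_num; exact he)
  obtain ⟨c2, d2⟩ := aux_dz 0 (fun z t => deriv (fun z' => e z' t) z) (by simpa using c1)
  have hc2 := c2.continuous
  have hc0 := he.continuous
  refine ⟨?_, fun z => d1 z t, fun z => d2 z t,
    hc2.comp (by fun_prop : Continuous (fun z : ℝ => (z, t)))⟩
  have hsq : Continuous (Function.uncurry fun z t => e z t ^ 2) := by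
    have h : (Function.uncurry fun z t => e z t ^ 2) = fun p => Function.uncurry e p ^ 2 := rfl
    rw [h]
    fun_prop
  have hpr : Continuous (Function.uncurry fun z t =>
      2 * α * (e z t * deriv (fun z' => deriv (fun z'' => e z'' t) z') z)) := by
    have h : (Function.uncurry fun z t =>
      2 * α * (e z t * deriv (fun z' => deriv (fun z'' => e z'' t) z') z)) =
      fun p => 2 * α * (Function.uncurry e p * (Function.uncurry fun z t =>
        deriv (fun z' => deriv (fun z'' => e z'' t) z') z) p) := rfl
    rw [h]
    exact continuous_const.mul (hc0.mul hc2)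
  have := aux_leibniz (fun z t => e z t ^ 2)
    (fun z t => 2 * α * (e z t * deriv (fun z' => deriv (fun z'' => e z'' t) z') z))
    hsq hpr (fun z t => by
      refine ((aux_dt e he z t).pow 2).congr_deriv ?_
      rw [heat]; simp; ring) γ t c (hγ t) (by simp [hb])
  rwa [intervalIntegral.integral_const_mul] at this

/-- Exponential decay of the Lyapunov functional for the
closed-loop two-phase Stefan problem with spatially constant reference:
`V(t) ≤ V(0) exp(-C t)` for `t ≥ 0`, with `C = min(α_s, α_l)/(2Γ_l²)`. -/
theorem stmt_8
    (Γl αs αl κs κl : ℝ)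
    (hΓl : 0 < Γl) (hαs : 0 < αs) (hαl : 0 < αl)
    (hκs : 0 ≤ κs) (hκl : 1 / (2 * Γl) ≤ κl)
    (γ : ℝ → ℝ) (hγ : Differentiable ℝ γ)
    (hγ0 : ∀ t, 0 < γ t) (hγΓ : ∀ t, γ t < Γl)
    (es el : ℝ → ℝ → ℝ)
    (hes : ContDiff ℝ 2 (Function.uncurry es))
    (hel : ContDiff ℝ 2 (Function.uncurry el))
    (heats : ∀ z t, deriv (fun s => es z s) t
      = αs * deriv (fun z' => deriv (fun z'' => es z'' t) z') z)
    (heatl : ∀ z t, deriv (fun s => el z s) t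
      = αl * deriv (fun z' => deriv (fun z'' => el z'' t) z') z)
    (hbs : ∀ t, es (γ t) t = 0) (hbl : ∀ t, el (γ t) t = 0)
    (hrobs : ∀ t, deriv (fun z => es z t) 0 = κs * es 0 t)
    (hrobl : ∀ t, deriv (fun z => el z t) Γl = -(κl * el Γl t))
    (V : ℝ → ℝ)
    (hV : ∀ t, V t = (1/2) * (∫ z in (0:ℝ)..(γ t), (es z t)^2)
      + (1/2) * ∫ z in (γ t)..Γl, (el z t)^2)
    (C : ℝ) (hC : C = min αs αl / (2 * Γl^2)) :
    ∀ t, 0 ≤ t → V t ≤ V 0 * Real.exp (-C * t) := by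
  have hκl0 : 0 ≤ κl := le_trans (by positivity) hκl
  have hm : 0 < min αs αl := lt_min hαs hαl
  have hder : ∀ t, ∃ v, HasDerivAt V v t ∧ v ≤ -C * V t := by
    intro t
    obtain ⟨s0, s1, s2, s3⟩ := aux_phase αs es hes heats γ hγ hbs 0 t
    obtain ⟨l0, l1, l2, l3⟩ := aux_phase αl el hel heatl γ hγ hbl Γl t
    have hVf : V = fun t => (1/2) * (∫ z in (0:ℝ)..(γ t), (es z t)^2)
      - (1/2) * ∫ z in Γl..(γ t), (el z t)^2 := by
      ext s
      rw [hV s, intervalIntegral.integral_symm Γl (γ s)]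
      ring
    refine ⟨_, by rw [hVf]; exact (s0.const_mul (1/2)).sub (l0.const_mul (1/2)), ?_⟩
    have Es := aux_energy _ _ _ s1 s2 s3 0 (γ t) 0 Γl (hγ0 t).le hΓl
      (fun z hz => by
        rw [sub_zero, abs_of_nonneg hz.1]; exact hz.2.trans (hγΓ t).le)
      (by
        simp only [hbs, hrobs, zero_mul]
        nlinarith [mul_nonneg hκs (sq_nonneg (es 0 t))])
      (by simp [hbs])
    have El := aux_energy _ _ _ l1 l2 l3 (γ t) Γl Γl Γl (hγΓ t).le hΓl
      (fun z hz => by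
        have := hz.1; have := hz.2; have := hγ0 t
        rw [abs_le]; constructor <;> linarith)
      (by
        simp only [hbl, hrobl, zero_mul]
        nlinarith [mul_nonneg hκl0 (sq_nonneg (el Γl t))])
      (by simp [hbl])
    have Is : 0 ≤ ∫ z in (0:ℝ)..(γ t), (es z t)^2 :=
      intervalIntegral.integral_nonneg (hγ0 t).le fun z _ => sq_nonneg _
    have Il : 0 ≤ ∫ z in (γ t)..Γl, (el z t)^2 :=
      intervalIntegral.integral_nonneg (hγΓ t).le fun z _ => sq_nonneg _
    rw [intervalIntegral.integral_symm (γ t) Γl, hV t]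
    generalize (∫ z in (0:ℝ)..(γ t), (es z t)^2) = A at *
    generalize (∫ z in (γ t)..Γl, (el z t)^2) = B at *
    have hCe : C = min αs αl * (2 * (1 / (4 * Γl ^ 2))) := by
      rw [hC]; field_simp; norm_num
    have hk : 0 < 1 / (4 * Γl ^ 2) := by positivity
    generalize 1 / (4 * Γl ^ 2) = k at *
    have e1 := mul_le_mul_of_nonneg_left Es hαs.le
    have e2 := mul_le_mul_of_nonneg_left El hαl.le
    have f1 := mul_le_mul_of_nonneg_right (min_le_left αs αl) (mul_nonneg hk.le Is)
    have f2 := mul_le_mul_of_nonneg_right (min_le_right αs αl) (mul_nonneg hk.le Il)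
    rw [hCe]
    linarith
  intro t ht
  choose v hv hle using hder
  have hW : ∀ s, HasDerivAt (fun s => V s * Real.exp (C * s))
      (v s * Real.exp (C * s) + V s * (Real.exp (C * s) * C)) s := fun s =>
    (hv s).mul (by simpa using ((hasDerivAt_id s).const_mul C).exp)
  have hanti : Antitone (fun s => V s * Real.exp (C * s)) := by
    refine antitone_of_deriv_nonpos (fun s => (hW s).differentiableAt) fun s => ?_
    rw [(hW s).deriv]
    nlinarith [Real.exp_pos (C * s), hle s]
  have h := hanti ht
  simp only [mul_zero, Real.exp_zero, mul_one] at h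
  rw [neg_mul, Real.exp_neg, ← div_eq_mul_inv, le_div_iff₀ (Real.exp_pos _)]
  exact h
end

section
/- Let Γ_l > 0, α_s > 0, α_l > 0, κ_s ≥ 0, κ_l ≥ 1/(2Γ_l) and M ≥ 0. Let γ : ℝ → ℝ and w : ℝ → ℝ be continuous functions with γ differentiable and 0 < γ(t) < Γ_l for all t, and let e_s, e_l : ℝ × ℝ → ℝ be twice continuously differentiable and f_s, f_l : ℝ × ℝ → ℝ continuous with |f_s(z,t)| ≤ M and |f_l(z,t)| ≤ M for all (z,t). Suppose: (i) ∂t e_s(z,t) = α_s ∂z² e_s(z,t) + w(t) f_s(z,t) and ∂t e_l(z,t) = α_l ∂z² e_l(z,t) + w(t) f_l(z,t) for all (z,t) ∈ ℝ × ℝ; (ii) e_s(γ(t),t) = 0 and e_l(γ(t),t) = 0 for all t; (iii) ∂z e_s(0,t) = κ_s e_s(0,t) and ∂z e_l(Γ_l,t) = −κ_l e_l(Γ_l,t) for all t. Define V(t) := (1/2) ∫_0^{γ(t)} e_s(z,t)² dz + (1/2) ∫_{γ(t)}^{Γ_l} e_l(z,t)² dz, C := min(α_s, α_l)/(2Γ_l²)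 and K := √2 · M · √(Γ_l). Then V is differentiable and for all t: V'(t) ≤ −C · V(t) + |w(t)| · K · √(V(t)). -/
open Set Filter Topology MeasureTheory in
lemma aux_leibniz_s9 (g : ℝ → ℝ → ℝ) (hg : ContDiff ℝ 1 (Function.uncurry g)) (a b t0 : ℝ) :
    HasDerivAt (fun t => ∫ z in a..b, g z t)
      (∫ z in a..b, deriv (fun s => g z s) t0) t0 := by
  have hd : ∀ z t, HasDerivAt (fun s => g z s)
      (fderiv ℝ (Function.uncurry g) (z, t) (0, 1)) t := by
    intro z t
    have h1 : HasFDerivAt (Function.uncurry g) (fderiv ℝ (Function.uncurry g) (z, t)) (z, t) :=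
      (hg.differentiable (by norm_num) (z, t)).hasFDerivAt
    have h2 : HasDerivAt (fun s : ℝ => (z, s)) ((0 : ℝ), (1 : ℝ)) t :=
      (hasDerivAt_const t z).prodMk (hasDerivAt_id t)
    exact h1.comp_hasDerivAt t h2
  have hc : Continuous (fun p : ℝ × ℝ => fderiv ℝ (Function.uncurry g) p (0, 1)) :=
    (hg.continuous_fderiv (by norm_num)).clm_apply continuous_const
  have hgc : Continuous (Function.uncurry g) := hg.continuous
  obtain ⟨B, hB⟩ := (isCompact_uIcc.prod (isCompact_closedBall t0 1) :
    IsCompact (uIcc a b ×ˢ Metric.closedBall t0 1)).exists_bound_of_continuousOn hc.continuousOn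
  have hsl : ∀ t, Continuous (fun z => g z t) := fun t =>
    hgc.comp (continuous_id.prodMk continuous_const)
  have hcl : Continuous (fun z => fderiv ℝ (Function.uncurry g) (z, t0) (0, 1)) :=
    hc.comp (continuous_id.prodMk continuous_const)
  have key := (intervalIntegral.hasDerivAt_integral_of_dominated_loc_of_deriv_le
    (μ := volume) (F := fun t z => g z t)
    (F' := fun t z => fderiv ℝ (Function.uncurry g) (z, t) (0, 1)) (x₀ := t0)
    (a := a) (b := b) (bound := fun _ => B) (s := Metric.ball t0 1)
    (Metric.ball_mem_nhds t0 one_pos)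
    (Eventually.of_forall fun t => (hsl t).aestronglyMeasurable)
    ((hsl t0).intervalIntegrable a b)
    hcl.aestronglyMeasurable
    (Eventually.of_forall fun z hz t ht =>
      hB (z, t) ⟨uIoc_subset_uIcc hz, Metric.ball_subset_closedBall ht⟩)
    (intervalIntegrable_const)
    (Eventually.of_forall fun z hz t ht => hd z t)).2
  simpa only [(hd _ t0).deriv] using key

open Set Filter Topology MeasureTheory Asymptotics in
lemma aux_moving (g : ℝ → ℝ → ℝ) (hg : ContDiff ℝ 1 (Function.uncurry g)) (γ : ℝ → ℝ)
    (a t0 : ℝ) (hγ : DifferentiableAt ℝ γ t0) (h0 : g (γ t0) t0 = 0) :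
    HasDerivAt (fun t => ∫ z in a..γ t, g z t)
      (∫ z in a..γ t0, deriv (fun s => g z s) t0) t0 := by
  have hsl : ∀ t, Continuous (fun z => g z t) := fun t =>
    hg.continuous.comp (continuous_id.prodMk continuous_const)
  have hsplit : (fun t => ∫ z in a..γ t, g z t) =
      fun t => (∫ z in a..γ t0, g z t) + ∫ z in γ t0..γ t, g z t := by
    ext t
    exact (intervalIntegral.integral_add_adjacent_intervals
      ((hsl t).intervalIntegrable _ _) ((hsl t).intervalIntegrable _ _)).symm
  rw [hsplit]
  have h2 : HasDerivAt (fun t => ∫ z in γ t0..γ t, g z t) 0 t0 := by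
    rw [hasDerivAt_iff_isLittleO]
    have ho : (fun t => ∫ z in γ t0..γ t, g z t) =o[𝓝 t0] (fun t => γ t - γ t0) := by
      rw [isLittleO_iff]
      intro ε hε
      have hev : ∀ᶠ p in 𝓝 (γ t0, t0), ‖Function.uncurry g p‖ < ε := by
        have := hg.continuous.norm.tendsto (γ t0, t0)
        refine this.eventually_lt_const ?_
        simpa [Function.uncurry, h0] using hε
      obtain ⟨δ, hδ, hball⟩ := Metric.eventually_nhds_iff.1 hev
      have h3 : ∀ᶠ t in 𝓝 t0, dist (γ t) (γ t0) < δ :=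
        hγ.continuousAt.eventually (Metric.ball_mem_nhds _ hδ)
      have h4 : ∀ᶠ t in 𝓝 t0, dist t t0 < δ := Metric.ball_mem_nhds _ hδ
      filter_upwards [h3, h4] with t h3 h4
      rw [Real.norm_eq_abs (γ t - γ t0)]
      apply intervalIntegral.norm_integral_le_of_norm_le_const
      intro z hz
      have hz' : dist z (γ t0) < δ := by
        refine lt_of_le_of_lt ?_ h3
        rw [Real.dist_eq, Real.dist_eq]
        exact abs_sub_left_of_mem_uIcc (uIoc_subset_uIcc hz)
      refine (hball (y := (z, t)) ?_).le
      rw [Prod.dist_eq]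
      exact max_lt hz' h4
    simpa using ho.trans_isBigO hγ.isBigO_sub
  exact ((aux_leibniz_s9 g hg a (γ t0) t0).add h2).congr_deriv (add_zero _)

open MeasureTheory in
/-- Derivative of the energy of a phase. -/
lemma aux_deriv (e : ℝ → ℝ → ℝ) (he : ContDiff ℝ 2 (Function.uncurry e)) (γ : ℝ → ℝ)
    (a t : ℝ) (hγ : DifferentiableAt ℝ γ t) (h0 : e (γ t) t = 0) :
    HasDerivAt (fun t => ∫ z in a..γ t, (e z t) ^ 2)
      (∫ z in a..γ t, 2 * (e z t * deriv (fun s => e z s) t)) t := by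
  have h := aux_moving (fun z t => (e z t) ^ 2)
    ((he.of_le (by norm_num)).pow 2 : ContDiff ℝ 1 fun p => (Function.uncurry e p) ^ 2)
    γ a t hγ (by simp [h0])
  convert h using 1
  apply intervalIntegral.integral_congr
  intro z _
  have hd : DifferentiableAt ℝ (fun s => e z s) t :=
    ((he.comp (contDiff_const.prodMk contDiff_id) :
      ContDiff ℝ 2 (fun s => e z s)).differentiable (by norm_num)) t
  have := (hd.hasDerivAt.pow 2).deriv
  simp only [Pi.pow_def] at this
  simp only [this]
  push_cast
  ring

open MeasureTheory Set in
lemma aux_energy_s9 (u h : ℝ → ℝ) (hu : ContDiff ℝ 2 u) (hh : Continuous h) (a b c L α w : ℝ)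
    (hab : a ≤ b) (hL : ∀ z ∈ Icc a b, |z - c| ≤ L) (hLp : 0 < L) (hα : 0 < α)
    (hbd : (b - c) * u b ^ 2 - (a - c) * u a ^ 2 = 0)
    (hrob : u b * deriv u b - u a * deriv u a ≤ 0) :
    ∫ z in a..b, u z * (α * deriv (deriv u) z + w * h z)
      ≤ -(α / (4 * L ^ 2)) * (∫ z in a..b, u z ^ 2) + w * ∫ z in a..b, u z * h z := by
  have hu1 : ContDiff ℝ 1 (deriv u) := by
    have : ContDiff ℝ (1 + 1) u := by simpa [one_add_one_eq_two] using hu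
    exact (contDiff_succ_iff_deriv.1 this).2.2
  have cu : Continuous u := hu.continuous
  have cu1 : Continuous (deriv u) := hu1.continuous
  have cu2 : Continuous (deriv (deriv u)) := hu1.continuous_deriv (by norm_num)
  have d0 : ∀ z, HasDerivAt u (deriv u z) z := fun z =>
    (hu.differentiable (by norm_num) z).hasDerivAt
  have d1 : ∀ z, HasDerivAt (deriv u) (deriv (deriv u) z) z := fun z =>
    (hu1.differentiable (by norm_num) z).hasDerivAt
  have I1 : ∫ z in a..b, (deriv u z ^ 2 + u z * deriv (deriv u) z)
      = u b * deriv u b - u a * deriv u a := by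
    refine intervalIntegral.integral_eq_sub_of_hasDerivAt (f := fun z => u z * deriv u z)
      (fun z _ => ?_) (Continuous.intervalIntegrable (by fun_prop) _ _)
    exact ((d0 z).mul (d1 z)).congr_deriv (by ring)
  have I2 : ∫ z in a..b, (u z ^ 2 + 2 * (z - c) * (u z * deriv u z)) = 0 := by
    rw [← hbd]
    refine intervalIntegral.integral_eq_sub_of_hasDerivAt (f := fun z => (z - c) * u z ^ 2)
      (fun z _ => ?_) (Continuous.intervalIntegrable (by fun_prop) _ _)
    refine (((hasDerivAt_id z).sub_const c).mul ((d0 z).pow 2)).congr_deriv ?_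
    simp
    ring
  have I3 : ∫ z in a..b, ((1 / 2) * u z ^ 2 - 2 * L ^ 2 * deriv u z ^ 2)
      ≤ ∫ z in a..b, (u z ^ 2 + 2 * (z - c) * (u z * deriv u z)) := by
    refine intervalIntegral.integral_mono_on hab
      (Continuous.intervalIntegrable (by fun_prop) _ _)
      (Continuous.intervalIntegrable (by fun_prop) _ _) (fun z hz => ?_)
    have h1 : (z - c) ^ 2 ≤ L ^ 2 := sq_le_sq' (abs_le.1 (hL z hz)).1 (abs_le.1 (hL z hz)).2
    nlinarith [sq_nonneg (u z + 2 * (z - c) * deriv u z), mul_le_mul_of_nonneg_right h1 (sq_nonneg (deriv u z))]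
  have i : ∀ f : ℝ → ℝ, Continuous f → IntervalIntegrable f volume a b :=
    fun f hf => hf.intervalIntegrable _ _
  rw [I2, intervalIntegral.integral_sub (i _ (by fun_prop)) (i _ (by fun_prop)),
    intervalIntegral.integral_const_mul, intervalIntegral.integral_const_mul] at I3
  rw [intervalIntegral.integral_add (i _ (by fun_prop)) (i _ (by fun_prop))] at I1
  have E : ∫ z in a..b, u z * (α * deriv (deriv u) z + w * h z)
      = α * (∫ z in a..b, u z * deriv (deriv u) z) + w * ∫ z in a..b, u z * h z := by
    rw [← intervalIntegral.integral_const_mul, ← intervalIntegral.integral_const_mul,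
      ← intervalIntegral.integral_add (i _ (by fun_prop)) (i _ (by fun_prop))]
    congr 1
    ext z
    ring
  rw [E]
  refine add_le_add ?_ le_rfl
  have h5 : ∫ z in a..b, u z * deriv (deriv u) z ≤ -(∫ z in a..b, deriv u z ^ 2) := by linarith
  have h6 : (∫ z in a..b, u z ^ 2) / (4 * L ^ 2) ≤ ∫ z in a..b, deriv u z ^ 2 := by
    rw [div_le_iff₀ (by positivity)]
    linarith
  calc _ ≤ α * -((∫ z in a..b, u z ^ 2) / (4 * L ^ 2)) := by
        apply mul_le_mul_of_nonneg_left _ hα.le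
        linarith
    _ = _ := by ring

open MeasureTheory Set in
lemma aux_quad (u h : ℝ → ℝ) (cu : Continuous u) (ch : Continuous h) (a b M x : ℝ)
    (hab : a ≤ b) (hM : ∀ z, |h z| ≤ M) :
    0 ≤ (∫ z in a..b, u z ^ 2) * (x * x) + (-2 * ∫ z in a..b, u z * h z) * x
      + M ^ 2 * (b - a) := by
  have i : ∀ f : ℝ → ℝ, Continuous f → IntervalIntegrable f volume a b :=
    fun f hf => hf.intervalIntegrable _ _
  have h0 : 0 ≤ ∫ z in a..b, (x * x * u z ^ 2 + (-2 * x) * (u z * h z) + M ^ 2) := by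
    refine intervalIntegral.integral_nonneg hab fun z _ => ?_
    have h1 : h z ^ 2 ≤ M ^ 2 := sq_le_sq' (abs_le.1 (hM z)).1 (abs_le.1 (hM z)).2
    nlinarith [sq_nonneg (x * u z - h z)]
  rw [intervalIntegral.integral_add (i _ (by fun_prop)) (i _ (by fun_prop)),
    intervalIntegral.integral_add (i _ (by fun_prop)) (i _ (by fun_prop)),
    intervalIntegral.integral_const_mul, intervalIntegral.integral_const_mul,
    intervalIntegral.integral_const, smul_eq_mul] at h0
  linarith

/-- Lyapunov estimate for the closed-loop two-phase Stefan problem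
with a general reference profile: the source terms `w(t) f_∘(z,t)` (with
`|f_∘| ≤ M`) yield `V'(t) ≤ -C V(t) + |w(t)| K √(V(t))` with
`C = min(α_s, α_l)/(2Γ_l²)` and `K = √2 M √Γ_l`. -/
theorem stmt_9
    (Γl αs αl κs κl M : ℝ)
    (hΓl : 0 < Γl) (hαs : 0 < αs) (hαl : 0 < αl)
    (hκs : 0 ≤ κs) (hκl : 1 / (2 * Γl) ≤ κl) (hM : 0 ≤ M)
    (γ w : ℝ → ℝ) (hγc : Continuous γ) (hw : Continuous w)
    (hγ : Differentiable ℝ γ)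
    (hγ0 : ∀ t, 0 < γ t) (hγΓ : ∀ t, γ t < Γl)
    (es el : ℝ → ℝ → ℝ)
    (hes : ContDiff ℝ 2 (Function.uncurry es))
    (hel : ContDiff ℝ 2 (Function.uncurry el))
    (fs fl : ℝ → ℝ → ℝ)
    (hfs : Continuous (Function.uncurry fs))
    (hfl : Continuous (Function.uncurry fl))
    (hfsM : ∀ z t, |fs z t| ≤ M) (hflM : ∀ z t, |fl z t| ≤ M)
    (heats : ∀ z t, deriv (fun s => es z s) t
      = αs * deriv (fun z' => deriv (fun z'' => es z'' t) z') z + w t * fs z t)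
    (heatl : ∀ z t, deriv (fun s => el z s) t
      = αl * deriv (fun z' => deriv (fun z'' => el z'' t) z') z + w t * fl z t)
    (hbs : ∀ t, es (γ t) t = 0) (hbl : ∀ t, el (γ t) t = 0)
    (hrobs : ∀ t, deriv (fun z => es z t) 0 = κs * es 0 t)
    (hrobl : ∀ t, deriv (fun z => el z t) Γl = -(κl * el Γl t))
    (V : ℝ → ℝ)
    (hV : ∀ t, V t = (1/2) * (∫ z in (0:ℝ)..(γ t), (es z t)^2)
      + (1/2) * ∫ z in (γ t)..Γl, (el z t)^2)
    (C K : ℝ) (hC : C = min αs αl / (2 * Γl^2))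
    (hK : K = Real.sqrt 2 * M * Real.sqrt Γl) :
    Differentiable ℝ V ∧ ∀ t, deriv V t
      ≤ -C * V t + |w t| * K * Real.sqrt (V t) := by
  have hVd : ∀ t, HasDerivAt V
      ((∫ z in (0:ℝ)..(γ t), es z t * deriv (fun s => es z s) t)
        + ∫ z in (γ t)..Γl, el z t * deriv (fun s => el z s) t) t := by
    intro t
    have h1 := aux_deriv es hes γ 0 t (hγ t) (hbs t)
    have h2 := aux_deriv el hel γ Γl t (hγ t) (hbl t)
    have h3 := (h1.const_mul (1/2)).sub (h2.const_mul (1/2))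
    have hVe : V = fun t => (1/2) * (∫ z in (0:ℝ)..(γ t), (es z t)^2)
        - (1/2) * ∫ z in Γl..(γ t), (el z t)^2 := by
      ext t
      rw [hV t, intervalIntegral.integral_symm (γ t) Γl]
      ring
    rw [hVe]
    refine h3.congr_deriv ?_
    rw [intervalIntegral.integral_const_mul, intervalIntegral.integral_const_mul,
      intervalIntegral.integral_symm (γ t) Γl]
    ring
  refine ⟨fun t => (hVd t).differentiableAt, fun t => ?_⟩
  rw [(hVd t).deriv]
  have κl0 : 0 ≤ κl := le_trans (by positivity) hκl
  have us : ContDiff ℝ 2 (fun z => es z t) := hes.comp (contDiff_id.prodMk contDiff_const)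
  have ul : ContDiff ℝ 2 (fun z => el z t) := hel.comp (contDiff_id.prodMk contDiff_const)
  have vs : Continuous (fun z => fs z t) := hfs.comp (continuous_id.prodMk continuous_const)
  have vl : Continuous (fun z => fl z t) := hfl.comp (continuous_id.prodMk continuous_const)
  have Es := aux_energy_s9 (fun z => es z t) (fun z => fs z t) us vs 0 (γ t) 0 Γl αs (w t)
    (hγ0 t).le (fun z hz => by
      rw [abs_le]; constructor <;> linarith [hz.1, hz.2, hγΓ t]) hΓl hαs
    (by simp [hbs t])
    (by
      simp only [hbs t, hrobs t]
      nlinarith [mul_nonneg hκs (sq_nonneg (es 0 t))])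
  have El := aux_energy_s9 (fun z => el z t) (fun z => fl z t) ul vl (γ t) Γl Γl Γl αl (w t)
    (hγΓ t).le (fun z hz => by
      rw [abs_le]; constructor <;> linarith [hz.1, hz.2, hγ0 t]) hΓl hαl
    (by simp [hbl t])
    (by
      simp only [hbl t, hrobl t]
      nlinarith [mul_nonneg κl0 (sq_nonneg (el Γl t))])
  simp only [heats, heatl]
  set A := ∫ z in (0:ℝ)..(γ t), (es z t)^2 with hA
  set B := ∫ z in (γ t)..Γl, (el z t)^2 with hB
  set g1 := ∫ z in (0:ℝ)..(γ t), es z t * fs z t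
  set g2 := ∫ z in (γ t)..Γl, el z t * fl z t
  have hA0 : 0 ≤ A := intervalIntegral.integral_nonneg (hγ0 t).le fun z _ => sq_nonneg _
  have hB0 : 0 ≤ B := intervalIntegral.integral_nonneg (hγΓ t).le fun z _ => sq_nonneg _
  have hdisc := discrim_le_zero (a := A + B) (b := -2 * (g1 + g2)) (c := M ^ 2 * Γl) (fun x => by
    have q1 := aux_quad (fun z => es z t) (fun z => fs z t) us.continuous vs 0 (γ t) M x
      (hγ0 t).le (fun z => hfsM z t)
    have q2 := aux_quad (fun z => el z t) (fun z => fl z t) ul.continuous vl (γ t) Γl M x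
      (hγΓ t).le (fun z => hflM z t)
    linarith)
  rw [discrim] at hdisc
  have hVt : V t = (A + B) / 2 := by rw [hV t]; ring
  have hV0 : 0 ≤ V t := by rw [hVt]; positivity
  have hg : |g1 + g2| ≤ K * Real.sqrt (V t) := by
    apply abs_le_of_sq_le_sq _ (by rw [hK]; positivity)
    rw [hK, mul_pow, mul_pow, mul_pow, Real.sq_sqrt hV0, Real.sq_sqrt hΓl.le,
      Real.sq_sqrt (by norm_num), hVt]
    linarith
  have hwg : w t * (g1 + g2) ≤ |w t| * (K * Real.sqrt (V t)) := by
    calc _ ≤ |w t * (g1 + g2)| := le_abs_self _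
      _ = |w t| * |g1 + g2| := abs_mul _ _
      _ ≤ _ := mul_le_mul_of_nonneg_left hg (abs_nonneg _)
  have hCs : C / 2 * A ≤ αs / (4 * Γl ^ 2) * A := by
    apply mul_le_mul_of_nonneg_right _ hA0
    rw [hC, div_div, show 2 * Γl ^ 2 * 2 = 4 * Γl ^ 2 by ring]
    gcongr
    exact min_le_left _ _
  have hCl : C / 2 * B ≤ αl / (4 * Γl ^ 2) * B := by
    apply mul_le_mul_of_nonneg_right _ hB0
    rw [hC, div_div, show 2 * Γl ^ 2 * 2 = 4 * Γl ^ 2 by ring]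
    gcongr
    exact min_le_right _ _
  have hCV : -C * V t = -(C / 2 * A) - C / 2 * B := by rw [hVt]; ring
  rw [hCV]
  have hfin := add_le_add Es El
  refine hfin.trans ?_
  linarith
end

section
/- Let α ∈ ℝ with α ≠ 0 and let v : ℝ → ℝ be continuous. Let f, g : ℝ × ℝ → ℝ be smooth (infinitely differentiable) functions such that: (i) ∂t h(z,t) = α ∂z² h(z,t) + v(t) ∂z h(z,t) for all (z,t) ∈ ℝ × ℝ, for both h = f and h = g; (ii) for all (z,t) ∈ ℝ × ℝ and both h = f and h = g, the spatial Taylor series at 0 represents h, i.e. h(z,t) = Σ_{i=0}^{∞} ∂z^i h(0,t) · z^i / i!. If f(0,t) = g(0,t) and ∂z f(0,t) = ∂z g(0,t) for all t ∈ ℝ, then f = g. -/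
lemma aux_z (h : ℝ → ℝ → ℝ) (hh : ContDiff ℝ (⊤ : ℕ∞) (Function.uncurry h)) (z t : ℝ) :
    HasDerivAt (fun z' => h z' t) (fderiv ℝ (Function.uncurry h) (z, t) (1, 0)) z := by
  have hd : HasFDerivAt (Function.uncurry h) (fderiv ℝ (Function.uncurry h) (z, t)) (z, t) :=
    (hh.differentiable (by simp) (z, t)).hasFDerivAt
  have hc : HasDerivAt (fun z' : ℝ => (z', t)) ((1 : ℝ), (0 : ℝ)) z :=
    (hasDerivAt_id z).prodMk (hasDerivAt_const z t)
  exact HasFDerivAt.comp_hasDerivAt z hd hc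

lemma aux_t (h : ℝ → ℝ → ℝ) (hh : ContDiff ℝ (⊤ : ℕ∞) (Function.uncurry h)) (z t : ℝ) :
    HasDerivAt (fun s => h z s) (fderiv ℝ (Function.uncurry h) (z, t) (0, 1)) t := by
  have hd : HasFDerivAt (Function.uncurry h) (fderiv ℝ (Function.uncurry h) (z, t)) (z, t) :=
    (hh.differentiable (by simp) (z, t)).hasFDerivAt
  have hc : HasDerivAt (fun s : ℝ => (z, s)) ((0 : ℝ), (1 : ℝ)) t :=
    (hasDerivAt_const t z).prodMk (hasDerivAt_id t)
  exact HasFDerivAt.comp_hasDerivAt t hd hc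

lemma aux_dir (h : ℝ → ℝ → ℝ) (hh : ContDiff ℝ (⊤ : ℕ∞) (Function.uncurry h)) (w : ℝ × ℝ) :
    ContDiff ℝ (⊤ : ℕ∞) (fun p => fderiv ℝ (Function.uncurry h) p w) :=
  (hh.fderiv_right (m := (⊤ : ℕ∞)) (by simp)).clm_apply contDiff_const

lemma aux_smooth (h : ℝ → ℝ → ℝ) (hh : ContDiff ℝ (⊤ : ℕ∞) (Function.uncurry h)) :
    ContDiff ℝ (⊤ : ℕ∞) (Function.uncurry (fun z t => deriv (fun z' => h z' t) z)) := by
  have : Function.uncurry (fun z t => deriv (fun z' => h z' t) z)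
      = fun p => fderiv ℝ (Function.uncurry h) p (1, 0) := by
    ext ⟨z, t⟩
    exact (aux_z h hh z t).deriv
  rw [this]
  exact aux_dir h hh _

lemma aux_symm (h : ℝ → ℝ → ℝ) (hh : ContDiff ℝ (⊤ : ℕ∞) (Function.uncurry h)) (z t : ℝ) :
    deriv (fun s => deriv (fun z' => h z' s) z) t
      = deriv (fun z' => deriv (fun s => h z' s) t) z := by
  have e1 : (fun s => deriv (fun z' => h z' s) z)
      = fun s => (fun a b => fderiv ℝ (Function.uncurry h) (a, b) (1, 0)) z s := by
    ext s; exact (aux_z h hh z s).deriv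
  have e2 : (fun z' => deriv (fun s => h z' s) t)
      = fun z' => (fun a b => fderiv ℝ (Function.uncurry h) (a, b) (0, 1)) z' t := by
    ext z'; exact (aux_t h hh z' t).deriv
  rw [e1, e2, (aux_t (fun a b => fderiv ℝ (Function.uncurry h) (a, b) (1, 0)) (aux_dir h hh (1, 0)) z t).deriv, 
    (aux_z (fun a b => fderiv ℝ (Function.uncurry h) (a, b) (0, 1)) (aux_dir h hh (0, 1)) z t).deriv]
  have hd : DifferentiableAt ℝ (fderiv ℝ (Function.uncurry h)) (z, t) :=
    (hh.fderiv_right (m := (⊤ : ℕ∞)) (by simp)).differentiable (by simp) _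
  have key : ∀ w u : ℝ × ℝ, fderiv ℝ (fun p => fderiv ℝ (Function.uncurry h) p w) (z, t) u
      = fderiv ℝ (fderiv ℝ (Function.uncurry h)) (z, t) u w := by
    intro w u
    rw [fderiv_clm_apply hd (differentiableAt_const w)]
    simp
  have hs : IsSymmSndFDerivAt ℝ (Function.uncurry h) (z, t) :=
    hh.contDiffAt.isSymmSndFDerivAt (by
      rw [minSmoothness_of_isRCLikeNormedField]
      exact WithTop.coe_le_coe.2 (le_top : (2 : ℕ∞) ≤ ⊤))
  exact (key _ _).trans ((hs _ _).trans (key _ _).symm)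

lemma aux_eq (α : ℝ) (v : ℝ → ℝ) (h : ℝ → ℝ → ℝ)
    (hh : ContDiff ℝ (⊤ : ℕ∞) (Function.uncurry h))
    (heat : ∀ z t, deriv (fun s => h z s) t
      = α * deriv (fun z' => deriv (fun z'' => h z'' t) z') z
        + v t * deriv (fun z' => h z' t) z) (z t : ℝ) :
    deriv (fun s => deriv (fun z' => h z' s) z) t
      = α * deriv (fun z' => deriv (fun z'' => deriv (fun y => h y t) z'') z') z
        + v t * deriv (fun z' => deriv (fun y => h y t) z') z := by
  rw [aux_symm h hh]
  have e : (fun z' => deriv (fun s => h z' s) t) = fun z' =>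
      α * deriv (fun z' => deriv (fun z'' => h z'' t) z') z'
        + v t * deriv (fun z' => h z' t) z' := by
    ext z'; exact heat z' t
  rw [e]
  have d1 := (aux_z _ (aux_smooth h hh) z t).differentiableAt.hasDerivAt
  have d2 := (aux_z _ (aux_smooth _ (aux_smooth h hh)) z t).differentiableAt.hasDerivAt
  exact ((d2.const_mul α).add (d1.const_mul (v t))).deriv

lemma aux_main (α : ℝ) (hα : α ≠ 0) (v : ℝ → ℝ) (i : ℕ) : ∀ (f g : ℝ → ℝ → ℝ)
    (_ : ContDiff ℝ (⊤ : ℕ∞) (Function.uncurry f))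
    (_ : ContDiff ℝ (⊤ : ℕ∞) (Function.uncurry g))
    (_ : ∀ z t, deriv (fun s => f z s) t
      = α * deriv (fun z' => deriv (fun z'' => f z'' t) z') z
        + v t * deriv (fun z' => f z' t) z)
    (_ : ∀ z t, deriv (fun s => g z s) t
      = α * deriv (fun z' => deriv (fun z'' => g z'' t) z') z
        + v t * deriv (fun z' => g z' t) z)
    (_ : ∀ t, f 0 t = g 0 t)
    (_ : ∀ t, deriv (fun z => f z t) 0 = deriv (fun z => g z t) 0) (t : ℝ),
    iteratedDeriv i (fun z' => f z' t) 0 = iteratedDeriv i (fun z' => g z' t) 0 := by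
  induction i with
  | zero => intro f g _ _ _ _ h0 _ t; simpa using h0 t
  | succ n ih =>
    intro f g hf hg heatf heatg h0 h1 t
    rw [iteratedDeriv_succ', iteratedDeriv_succ']
    refine ih (fun z t => deriv (fun z' => f z' t) z) (fun z t => deriv (fun z' => g z' t) z)
      (aux_smooth f hf) (aux_smooth g hg) (aux_eq α v f hf heatf) (aux_eq α v g hg heatg)
      h1 (fun s => ?_) t
    have a := heatf 0 s
    have b := heatg 0 s
    have c : (fun s => f 0 s) = fun s => g 0 s := funext h0
    rw [c, b, h1 s] at a
    exact (mul_left_cancel₀ hα (add_right_cancel a)).symm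

/-- Differential flatness of the convection–diffusion equation:
two smooth, spatially analytic (Taylor-representable) solutions of
`∂t h = α ∂z² h + v(t) ∂z h` coinciding in value and spatial gradient at
`z = 0` for all times are identical. -/
theorem stmt_13
    (α : ℝ) (hα : α ≠ 0) (v : ℝ → ℝ) (hv : Continuous v)
    (f g : ℝ → ℝ → ℝ)
    (hf : ContDiff ℝ (⊤ : ℕ∞) (Function.uncurry f))
    (hg : ContDiff ℝ (⊤ : ℕ∞) (Function.uncurry g))
    (heatf : ∀ z t, deriv (fun s => f z s) t
      = α * deriv (fun z' => deriv (fun z'' => f z'' t) z') z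
        + v t * deriv (fun z' => f z' t) z)
    (heatg : ∀ z t, deriv (fun s => g z s) t
      = α * deriv (fun z' => deriv (fun z'' => g z'' t) z') z
        + v t * deriv (fun z' => g z' t) z)
    (taylorf : ∀ z t, f z t
      = ∑' i : ℕ, iteratedDeriv i (fun z' => f z' t) 0 * z ^ i / (Nat.factorial i))
    (taylorg : ∀ z t, g z t
      = ∑' i : ℕ, iteratedDeriv i (fun z' => g z' t) 0 * z ^ i / (Nat.factorial i))
    (h0 : ∀ t, f 0 t = g 0 t)
    (h1 : ∀ t, deriv (fun z => f z t) 0 = deriv (fun z => g z t) 0) :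
    f = g := by
  funext z t
  rw [taylorf, taylorg]
  refine tsum_congr fun i => ?_
  rw [aux_main α hα v i f g hf hg heatf heatg h0 h1 t]
end
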